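/- Let n be a positive integer, let M be a real symmetric positive definite n×n matrix with largest eigenvalue λ_max, let m be a positive integer, and let x₁, x₂ ∈ ℝ^n each have every coordinate in [0,1]. Then ‖(x₁ᵀ M x₁)^m x₁ − (x₂ᵀ M x₂)^m x₂‖ ≤ (1 + 2m) · (λ_max n)^m · ‖x₁ − x₂‖. -/

import Mathlib

theorem LinearMap.IsSymmetric.norm_apply_le_of_abs_eigenvalue_le {E : Type*}
    [NormedAddCommGroup E] [InnerProductSpace ℝ E] [FiniteDimensional ℝ E] {T : E →ₗ[ℝ] E}
    (hT : T.IsSymmetric) {c : ℝ}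
    (h : ∀ μ : ℝ, Module.End.HasEigenvalue T μ → |μ| ≤ c) (x : E) :
    ‖T x‖ ≤ c * ‖x‖ := by
  rcases eq_or_ne x 0 with rfl | hx
  · simp
  have : Nontrivial E := ⟨x, 0, hx⟩
  have hc : 0 ≤ c := (abs_nonneg _).trans (h _ hT.hasEigenvalue_iSup_of_finiteDimensional)
  refine le_of_sq_le_sq ?_ (by positivity)
  rw [mul_pow, ← (hT.eigenvectorBasis rfl).sum_sq_norm_inner_right,
    ← (hT.eigenvectorBasis rfl).sum_sq_norm_inner_right x, Finset.mul_sum]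
  refine Finset.sum_le_sum fun i _ => ?_
  rw [← OrthonormalBasis.repr_apply_apply, ← OrthonormalBasis.repr_apply_apply,
    hT.eigenvectorBasis_apply_self_apply, norm_mul, mul_pow]
  gcongr
  exact h _ (hT.hasEigenvalue_eigenvalues rfl i)

theorem LinearMap.IsSymmetric.inner_map_self_sub_inner_map_self {E : Type*}
    [NormedAddCommGroup E] [InnerProductSpace ℝ E] {T : E →ₗ[ℝ] E}
    (hT : T.IsSymmetric) (x y : E) :
    inner ℝ (T x) x - inner ℝ (T y) y = inner ℝ (T (x + y)) (x - y) := by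
  have h := hT x y
  rw [real_inner_comm] at h
  simp only [map_add, inner_add_left, inner_sub_right, h, real_inner_comm]
  rw [← h]
  ring_nf

theorem norm_inner_map_self_pow_smul_sub_le {E : Type*}
    [NormedAddCommGroup E] [InnerProductSpace ℝ E] {T : E →ₗ[ℝ] E}
    (hT : T.IsSymmetric) {c r : ℝ} (hc : 0 ≤ c) (hcT : ∀ x, ‖T x‖ ≤ c * ‖x‖) (m : ℕ) {x y : E}
    (hx : ‖x‖ ≤ r) (hy : ‖y‖ ≤ r) :
    ‖(inner ℝ (T x) x) ^ m • x - (inner ℝ (T y) y) ^ m • y‖ ≤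
      (1 + 2 * (m : ℝ)) * (c * r ^ 2) ^ m * ‖x - y‖ := by
  have hr : 0 ≤ r := (norm_nonneg x).trans hx
  have hq : ∀ z : E, ‖z‖ ≤ r → |inner ℝ (T z) z| ≤ c * r ^ 2 := fun z hz => calc
    |inner ℝ (T z) z| ≤ ‖T z‖ * ‖z‖ := abs_real_inner_le_norm _ _
    _ ≤ c * ‖z‖ * ‖z‖ := by gcongr; exact hcT z
    _ ≤ c * r * r := by gcongr
    _ = c * r ^ 2 := by ring
  have hdiff : |inner ℝ (T x) x - inner ℝ (T y) y| ≤ 2 * c * r * ‖x - y‖ := by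
    rw [hT.inner_map_self_sub_inner_map_self]
    calc |inner ℝ (T (x + y)) (x - y)| ≤ ‖T (x + y)‖ * ‖x - y‖ := abs_real_inner_le_norm _ _
      _ ≤ c * (r + r) * ‖x - y‖ := by
        gcongr
        exact (hcT _).trans (by gcongr; exact norm_add_le_of_le hx hy)
      _ = 2 * c * r * ‖x - y‖ := by ring
  have hpow : |(inner ℝ (T x) x) ^ m - (inner ℝ (T y) y) ^ m| * r ≤
      2 * m * (c * r ^ 2) ^ m * ‖x - y‖ := by
    rcases m with _ | k
    · simp
    calc _ ≤ |inner ℝ (T x) x - inner ℝ (T y) y| * (k + 1 : ℕ) *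
          max |inner ℝ (T x) x| |inner ℝ (T y) y| ^ k * r := by
            gcongr
            exact abs_pow_sub_pow_le ..
      _ ≤ (2 * c * r * ‖x - y‖) * (k + 1 : ℕ) * (c * r ^ 2) ^ k * r := by
            gcongr
            exact max_le (hq x hx) (hq y hy)
      _ = _ := by ring
  calc _ = ‖(inner ℝ (T x) x) ^ m • (x - y) +
        ((inner ℝ (T x) x) ^ m - (inner ℝ (T y) y) ^ m) • y‖ := by
          congr 1
          module
    _ ≤ |inner ℝ (T x) x| ^ m * ‖x - y‖ +
        |(inner ℝ (T x) x) ^ m - (inner ℝ (T y) y) ^ m| * ‖y‖ := by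
          refine (norm_add_le _ _).trans_eq ?_
          simp only [norm_smul, Real.norm_eq_abs, abs_pow]
    _ ≤ (c * r ^ 2) ^ m * ‖x - y‖ + 2 * m * (c * r ^ 2) ^ m * ‖x - y‖ := by
          refine add_le_add ?_ (le_trans ?_ hpow)
          · gcongr
            exact hq x hx
          · gcongr
    _ = _ := by ring

theorem EuclideanSpace.norm_le_sqrt_card_of_mem_Icc {ι : Type*} [Fintype ι]
    {x : EuclideanSpace ℝ ι} (hx : ∀ i, x i ∈ Set.Icc (0 : ℝ) 1) :
    ‖x‖ ≤ √(Fintype.card ι) := by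
  rw [EuclideanSpace.norm_eq]
  gcongr
  calc ∑ i, ‖x i‖ ^ 2 ≤ ∑ _i : ι, (1 : ℝ) := by
        gcongr with i
        rw [Real.norm_of_nonneg (hx i).1]
        exact pow_le_one₀ (hx i).1 (hx i).2
    _ = Fintype.card ι := by simp

theorem Matrix.inner_toEuclideanLin_self {ι : Type*} [Fintype ι] [DecidableEq ι]
    (M : Matrix ι ι ℝ) (x : EuclideanSpace ℝ ι) :
    inner ℝ (M.toEuclideanLin x) x = ∑ i, ∑ j, x i * M i j * x j := by
  simp [PiLp.inner_apply, Matrix.mulVec, dotProduct, Finset.mul_sum, mul_assoc]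

/-- Lemma 5 of the paper: for a real symmetric positive definite `n × n` matrix `M`
with largest eigenvalue `lammax`, a positive integer `m`, and `x₁, x₂ ∈ [0,1]^n`,
`‖(x₁ᵀ M x₁)^m x₁ − (x₂ᵀ M x₂)^m x₂‖ ≤ (1 + 2m) (lammax n)^m ‖x₁ − x₂‖`. -/
theorem quadform_pow_smul_diff_bound (n : ℕ) (hn : 0 < n)
    (M : Matrix (Fin n) (Fin n) ℝ) (hM : M.PosDef) (lammax : ℝ)
    (hub : ∀ (μ : ℝ) (v : Fin n → ℝ), v ≠ 0 → M.mulVec v = μ • v → μ ≤ lammax)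
    (hmem : ∃ v : Fin n → ℝ, v ≠ 0 ∧ M.mulVec v = lammax • v)
    (m : ℕ) (hm : 0 < m)
    (x₁ x₂ : EuclideanSpace ℝ (Fin n))
    (hx₁ : ∀ i, x₁ i ∈ Set.Icc (0 : ℝ) 1) (hx₂ : ∀ i, x₂ i ∈ Set.Icc (0 : ℝ) 1) :
    ‖(∑ i, ∑ j, x₁ i * M i j * x₁ j) ^ m • x₁ -
        (∑ i, ∑ j, x₂ i * M i j * x₂ j) ^ m • x₂‖ ≤
      (1 + 2 * (m : ℝ)) * (lammax * n) ^ m * ‖x₁ - x₂‖ := by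
  have hsymm : M.toEuclideanLin.IsSymmetric :=
    Matrix.isSymmetric_toEuclideanLin_iff.mpr hM.isHermitian
  have heig : ∀ μ : ℝ, Module.End.HasEigenvalue M.toEuclideanLin μ → |μ| ≤ lammax := by
    intro μ hμ
    obtain ⟨v, hv⟩ := hμ.exists_hasEigenvector
    have hv0 : v.ofLp ≠ 0 := by simpa using hv.2
    have hMv : M.mulVec v.ofLp = μ • v.ofLp := congrArg WithLp.ofLp hv.apply_eq_smul
    have hpos : 0 < μ * (v.ofLp ⬝ᵥ v.ofLp) := by
      simpa [hMv] using hM.dotProduct_mulVec_pos hv0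
    have hμ0 : 0 < μ := pos_of_mul_pos_left hpos (by simpa using dotProduct_star_self_nonneg v.ofLp)
    rw [abs_of_pos hμ0]
    exact hub μ v.ofLp hv0 hMv
  obtain ⟨v, hv0, hMv⟩ := hmem
  have hlam : 0 ≤ lammax := by
    refine (abs_nonneg lammax).trans (heig lammax ?_)
    refine Module.End.hasEigenvalue_of_hasEigenvector (x := WithLp.toLp 2 v) ?_
    rw [Module.End.hasEigenvector_iff, Module.End.mem_eigenspace_iff]
    exact ⟨congrArg (WithLp.toLp 2) hMv, by simpa using hv0⟩
  have hnorm {x : EuclideanSpace ℝ (Fin n)} (hx : ∀ i, x i ∈ Set.Icc (0 : ℝ) 1) : ‖x‖ ≤ √n := by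
    simpa using EuclideanSpace.norm_le_sqrt_card_of_mem_Icc hx
  have h := norm_inner_map_self_pow_smul_sub_le hsymm hlam
    (hsymm.norm_apply_le_of_abs_eigenvalue_le heig) m (hnorm hx₁) (hnorm hx₂)
  rwa [Real.sq_sqrt n.cast_nonneg, M.inner_toEuclideanLin_self, M.inner_toEuclideanLin_self] at h
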